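/- arXiv:1405.5608 — 9 statements merged into one kernel-verified Lean document; each statement's English description precedes it below -/
import Mathlib

section
/- Let L ⊆ Σ* be a regular language, let A₁ be a DFA accepting L and A₂ be a DFA accepting the reversal Lᴿ. Define the product automaton B as follows: its states are pairs (p,q) of a state p of A₁ and a state q of A₂; its initial state is the pair of initial states; its forward transition is (p,q)·a = (δ₁(p,a), q) and its backward transition is (p,q)∘a = (p, δ₂(q,a)); a pair (p,q) is accepting iff u_p (v_q)ᴿ ∈ L, where u_p is any fixed word with δ₁(q₀⁽¹⁾,u_p)=p and v_q any fixed word with δ₂(q₀⁽²⁾,v_q)=q. Then B is a deterministic biautomaton (it satisfies the ⋄-property and the F-property) and L(B) = L. -/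
/-- A deterministic biautomaton with the diamond-property and the F-property. -/
structure DBiA (α : Type) (Q : Type) where
  fwd : Q → α → Q
  bwd : Q → α → Q
  start : Q
  accept : Set Q
  diamond : ∀ q a b, bwd (fwd q a) b = fwd (bwd q b) a
  fprop : ∀ q a, fwd q a ∈ accept ↔ bwd q a ∈ accept

namespace DBiA

variable {α Q : Type}

/-- Extended forward transition: q·λ = q, q·(av) = (q·a)·v. -/
def fwdW (A : DBiA α Q) (q : Q) (w : List α) : Q := w.foldl A.fwd q

/-- Extended backward transition: q∘λ = q, q∘(va) = (q∘a)∘v. -/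
def bwdW (A : DBiA α Q) (q : Q) (w : List α) : Q := w.foldr (fun a p => A.bwd p a) q

/-- The language accepted by a biautomaton. -/
def lang (A : DBiA α Q) : Set (List α) := {w | A.fwdW A.start w ∈ A.accept}

end DBiA

namespace DFA

variable {α σ : Type*}

/-- Words leading to the same state have the same right contexts in the accepted language. -/
theorem append_mem_accepts_congr (M : DFA α σ) {x y : List α} (h : M.eval x = M.eval y)
    (z : List α) : x ++ z ∈ M.accepts ↔ y ++ z ∈ M.accepts := by
  unfold DFA.eval at h
  simp only [DFA.mem_accepts, DFA.eval, DFA.evalFrom_of_append, h]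

end DFA

namespace DBiA

variable {α Q₁ Q₂ : Type}

/-- Membership of `x ++ y.reverse` in `L` depends only on the state that `x` reaches in a DFA for
`L` and the state that `y` reaches in a DFA for the reversal of `L`. -/
theorem append_reverse_mem_congr {L : Set (List α)} {A₁ : DFA α Q₁} {A₂ : DFA α Q₂}
    (h₁ : A₁.accepts = L) (h₂ : A₂.accepts = List.reverse '' L) {x x' y y' : List α}
    (hx : A₁.eval x = A₁.eval x') (hy : A₂.eval y = A₂.eval y') :
    x ++ y.reverse ∈ L ↔ x' ++ y'.reverse ∈ L := by
  have hrev (w : List α) : w ∈ A₂.accepts ↔ w.reverse ∈ L := by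
    rw [h₂]
    exact List.reverse_involutive.toPerm.image_eq_preimage_symm L ▸ Iff.rfl
  have hleft : x ++ y.reverse ∈ L ↔ x' ++ y.reverse ∈ L := by
    rw [← h₁]
    exact A₁.append_mem_accepts_congr hx _
  have hright := A₂.append_mem_accepts_congr hy x'.reverse
  simp only [hrev, List.reverse_append, List.reverse_reverse] at hright
  exact hleft.trans hright

/-- The product of a DFA for `L` and a DFA for the reversal of `L`, with accepting states
described by words `u p` and `v q` reaching the states `p` and `q`. -/
def ofDFAs {L : Set (List α)} {A₁ : DFA α Q₁} {A₂ : DFA α Q₂}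
    (h₁ : A₁.accepts = L) (h₂ : A₂.accepts = List.reverse '' L)
    {u : Q₁ → List α} {v : Q₂ → List α}
    (hu : ∀ p, A₁.eval (u p) = p) (hv : ∀ q, A₂.eval (v q) = q) : DBiA α (Q₁ × Q₂) where
  fwd pq a := (A₁.step pq.1 a, pq.2)
  bwd pq a := (pq.1, A₂.step pq.2 a)
  start := (A₁.start, A₂.start)
  accept := {pq | u pq.1 ++ (v pq.2).reverse ∈ L}
  diamond _ _ _ := rfl
  fprop := by
    rintro ⟨p, q⟩ a
    have hleft := append_reverse_mem_congr h₁ h₂ (x := u (A₁.step p a)) (x' := u p ++ [a])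
      (y := v q) (y' := v q) (by simp [hu]) rfl
    have hright := append_reverse_mem_congr h₁ h₂ (x := u p) (x' := u p)
      (y := v (A₂.step q a)) (y' := v q ++ [a]) rfl (by simp [hv])
    simp only [List.reverse_append, List.reverse_singleton, List.append_assoc] at hleft hright
    exact hleft.trans hright.symm

section ofDFAs

variable {L : Set (List α)} {A₁ : DFA α Q₁} {A₂ : DFA α Q₂}
  (h₁ : A₁.accepts = L) (h₂ : A₂.accepts = List.reverse '' L)
  {u : Q₁ → List α} {v : Q₂ → List α}
  (hu : ∀ p, A₁.eval (u p) = p) (hv : ∀ q, A₂.eval (v q) = q)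

theorem fwdW_ofDFAs (pq : Q₁ × Q₂) (w : List α) :
    (ofDFAs h₁ h₂ hu hv).fwdW pq w = (A₁.evalFrom pq.1 w, pq.2) := by
  induction w generalizing pq with
  | nil => rfl
  | cons a w ih => exact ih (A₁.step pq.1 a, pq.2)

theorem lang_ofDFAs : (ofDFAs h₁ h₂ hu hv).lang = L := by
  ext w
  have h := append_reverse_mem_congr h₁ h₂ (x := u (A₁.eval w)) (x' := w)
    (y := v A₂.start) (y' := []) (hu _) (hv _)
  rw [List.reverse_nil, List.append_nil] at h
  rw [← h, lang, Set.mem_ofPred_eq, fwdW_ofDFAs]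
  rfl

end ofDFAs

end DBiA

/-- the product of a DFA for L with a DFA for the reversal of L yields a
deterministic biautomaton (satisfying the diamond- and F-properties) accepting L. -/
theorem stmt_0 {α Q₁ Q₂ : Type} [Fintype Q₁] [Fintype Q₂]
    (L : Set (List α)) (A₁ : DFA α Q₁) (A₂ : DFA α Q₂)
    (h₁ : A₁.accepts = L) (h₂ : A₂.accepts = List.reverse '' L)
    (u : Q₁ → List α) (v : Q₂ → List α)
    (hu : ∀ p : Q₁, A₁.evalFrom A₁.start (u p) = p)
    (hv : ∀ q : Q₂, A₂.evalFrom A₂.start (v q) = q) :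
    ∃ B : DBiA α (Q₁ × Q₂),
      B.fwd = (fun pq a => (A₁.step pq.1 a, pq.2)) ∧
      B.bwd = (fun pq a => (pq.1, A₂.step pq.2 a)) ∧
      B.start = (A₁.start, A₂.start) ∧
      B.accept = {pq : Q₁ × Q₂ | u pq.1 ++ (v pq.2).reverse ∈ L} ∧
      B.lang = L := by
  exact ⟨DBiA.ofDFAs h₁ h₂ hu hv, rfl, rfl, rfl, rfl, DBiA.lang_ofDFAs h₁ h₂ hu hv⟩
end

section
/- If a regular language L ⊆ Σ* is accepted by a DFA with n states, and its reversal Lᴿ is accepted by a DFA with m states, then L is accepted by a deterministic biautomaton with at most n·m states. -/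
/-- The two-sided quotient `u⁻¹ L v⁻¹`. -/
def quotientBy {α : Type} (L : Set (List α)) (u v : List α) : Set (List α) :=
  {w | u ++ w ++ v ∈ L}

/-- The type of all two-sided quotients of `L` by words. -/
def TwoSidedQuotient {α : Type} (L : Set (List α)) : Type :=
  {K : Set (List α) // ∃ u v, quotientBy L u v = K}

/-- The biautomaton whose states are the two-sided quotients of `L`. -/
def quotientBiautomaton {α : Type} (L : Set (List α)) : DBiA α (TwoSidedQuotient L) where
  fwd q a := ⟨{w | a :: w ∈ q.1}, by
    obtain ⟨_, u, v, rfl⟩ := q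
    exact ⟨u ++ [a], v, by ext w; simp [quotientBy]⟩⟩
  bwd q a := ⟨{w | w ++ [a] ∈ q.1}, by
    obtain ⟨_, u, v, rfl⟩ := q
    exact ⟨u, a :: v, by ext w; simp [quotientBy]⟩⟩
  start := ⟨L, [], [], by ext w; simp [quotientBy]⟩
  accept := {q | [] ∈ q.1}
  diamond _ _ _ := rfl
  fprop _ _ := Iff.rfl

theorem fwdW_quotientBiautomaton_mem_accept {α : Type} (L : Set (List α))
    (q : TwoSidedQuotient L) (w : List α) :
    (quotientBiautomaton L).fwdW q w ∈ (quotientBiautomaton L).accept ↔ w ∈ q.1 := by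
  induction w generalizing q with
  | nil => rfl
  | cons a w ih => exact ih ((quotientBiautomaton L).fwd q a)

theorem lang_quotientBiautomaton {α : Type} (L : Set (List α)) :
    (quotientBiautomaton L).lang = L :=
  Set.ext fun w => fwdW_quotientBiautomaton_mem_accept L (quotientBiautomaton L).start w

theorem DFA.append_mem_accepts_congr_s1 {α Q : Type} (A : DFA α Q) {u u' : List α}
    (h : A.eval u = A.eval u') (w : List α) : u ++ w ∈ A.accepts ↔ u' ++ w ∈ A.accepts := by
  simp only [DFA.mem_accepts, DFA.eval] at h ⊢
  rw [DFA.evalFrom_of_append, DFA.evalFrom_of_append, h]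

theorem quotientBy_congr_left {α Q : Type} {L : Set (List α)} {A : DFA α Q}
    (hA : A.accepts = L) {u u' v : List α} (h : A.eval u = A.eval u') :
    quotientBy L u v = quotientBy L u' v := by
  ext w
  subst hA
  change u ++ w ++ v ∈ A.accepts ↔ u' ++ w ++ v ∈ A.accepts
  rw [List.append_assoc, List.append_assoc]
  exact A.append_mem_accepts_congr_s1 h _

theorem quotientBy_congr_right {α Q : Type} {L : Set (List α)} {A : DFA α Q}
    (hA : A.accepts = List.reverse '' L) {u v v' : List α}
    (h : A.eval v.reverse = A.eval v'.reverse) :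
    quotientBy L u v = quotientBy L u v' := by
  have mem_iff (x : List α) : x ∈ L ↔ x.reverse ∈ A.accepts := by
    rw [hA]
    exact (List.reverse_injective.mem_set_image).symm
  ext w
  change u ++ w ++ v ∈ L ↔ u ++ w ++ v' ∈ L
  rw [mem_iff, mem_iff, List.reverse_append (bs := v), List.reverse_append (bs := v')]
  exact A.append_mem_accepts_congr_s1 h _

/-- if L is accepted by an n-state DFA and its reversal by an m-state DFA,
then L is accepted by a deterministic biautomaton with at most n·m states. -/
theorem stmt_1 {α Q₁ Q₂ : Type} [Fintype Q₁] [Fintype Q₂]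
    (L : Set (List α)) (A₁ : DFA α Q₁) (A₂ : DFA α Q₂)
    (h₁ : A₁.accepts = L) (h₂ : A₂.accepts = List.reverse '' L) :
    ∃ (Q : Type) (i : Fintype Q) (B : DBiA α Q),
      @Fintype.card Q i ≤ Fintype.card Q₁ * Fintype.card Q₂ ∧ B.lang = L := by
  have hf : ∀ q : TwoSidedQuotient L,
      ∃ u v, q.1 = quotientBy L u v := fun q => q.2.imp fun u ⟨v, h⟩ => ⟨v, h.symm⟩
  choose u v huv using hf
  let f : TwoSidedQuotient L → Q₁ × Q₂ := fun q => (A₁.eval (u q), A₂.eval (v q).reverse)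
  have f_inj : Function.Injective f := by
    intro p q h
    obtain ⟨hl, hr⟩ := Prod.mk.inj h
    apply Subtype.ext
    rw [huv p, huv q, quotientBy_congr_left h₁ hl, quotientBy_congr_right h₂ hr]
  have : Finite (TwoSidedQuotient L) := Finite.of_injective f f_inj
  let i := Fintype.ofFinite (TwoSidedQuotient L)
  refine ⟨TwoSidedQuotient L, i, quotientBiautomaton L, ?_, lang_quotientBiautomaton L⟩
  rw [← Fintype.card_prod]
  exact Fintype.card_le_of_injective f f_inj
end

section
/- A regular language is accepted by some permutation DFA if and only if it is accepted by some permutation biautomaton. -/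
namespace DFA

variable {α Q : Type}

/-- The permutation of the states of a finite permutation DFA induced by a letter. -/
noncomputable def letterPerm [Finite Q] (A : DFA α Q)
    (hA : ∀ (p q : Q) (a : α), A.step p a = A.step q a → p = q) (a : α) : Equiv.Perm Q :=
  Equiv.ofBijective (fun q => A.step q a)
    (Finite.injective_iff_bijective.mp fun p q h => hA p q a h)

/-- The biautomaton of a permutation DFA: a state records the state reached by the prefix read so
far and the permutation induced by the suffix read so far. -/
noncomputable def toDBiA [Finite Q] (A : DFA α Q)
    (hA : ∀ (p q : Q) (a : α), A.step p a = A.step q a → p = q) :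
    DBiA α (Q × Equiv.Perm Q) where
  fwd s a := (A.step s.1 a, s.2)
  bwd s a := (s.1, s.2 * A.letterPerm hA a)
  start := (A.start, 1)
  accept := {s | s.2 s.1 ∈ A.accept}
  diamond _ _ _ := rfl
  fprop _ _ := Iff.rfl

theorem toDBiA_fwdW [Finite Q] (A : DFA α Q)
    (hA : ∀ (p q : Q) (a : α), A.step p a = A.step q a → p = q)
    (s : Q × Equiv.Perm Q) (w : List α) :
    (A.toDBiA hA).fwdW s w = (A.evalFrom s.1 w, s.2) := by
  induction w generalizing s with
  | nil => rfl
  | cons a w ih => exact ih (A.step s.1 a, s.2)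

theorem toDBiA_lang [Finite Q] (A : DFA α Q)
    (hA : ∀ (p q : Q) (a : α), A.step p a = A.step q a → p = q) :
    (A.toDBiA hA).lang = A.accepts := by
  ext w
  change (A.toDBiA hA).fwdW (A.start, 1) w ∈ (A.toDBiA hA).accept ↔ _
  rw [toDBiA_fwdW]
  exact Iff.rfl

end DFA

/-- a language is accepted by a permutation DFA iff it is accepted by a
permutation biautomaton. -/
theorem stmt_2 {α : Type} (L : Set (List α)) :
    (∃ (Q : Type) (_ : Fintype Q) (A : DFA α Q), A.accepts = L ∧
      ∀ (p q : Q) (a : α), A.step p a = A.step q a → p = q) ↔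
    (∃ (Q : Type) (_ : Fintype Q) (B : DBiA α Q), B.lang = L ∧
      ∀ (p q : Q) (a : α),
        (B.fwd p a = B.fwd q a → p = q) ∧ (B.bwd p a = B.bwd q a → p = q)) := by
  classical
  constructor
  · rintro ⟨Q, _, A, rfl, hA⟩
    refine ⟨Q × Equiv.Perm Q, inferInstance, A.toDBiA hA, A.toDBiA_lang hA,
      fun p q a => ⟨fun h => ?_, fun h => ?_⟩⟩
    · exact Prod.ext (hA _ _ a (congrArg Prod.fst h)) (congrArg (fun s => s.2) h)
    · exact Prod.ext (congrArg (fun s => s.1) h) (mul_right_cancel (congrArg Prod.snd h))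
  · rintro ⟨Q, _, B, rfl, hB⟩
    exact ⟨Q, inferInstance, ⟨B.fwd, B.start, B.accept⟩, rfl, fun p q a => (hB p q a).1⟩
end

section
/- Let Q be a finite set and π₁,π₂ : Q → Q be two mappings satisfying π₁(π₂(q)) = π₂(π₁(q)) for all q ∈ Q. If there exists a subset P ⊆ Q such that the mapping π defined by π(p) = π₂(π₁(p)) maps P bijectively onto P and π is not the identity on P, then there exists a subset P' ⊆ Q and an integer d ≥ 1 such that the d-fold iterate π₁^d or the d-fold iterate π₂^d maps P' bijectively onto P' and is not the identity on P'. -/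
/-- On a finite type, a point that is periodic under the composition of two commuting self-maps
is periodic under each of them. -/
theorem Function.Commute.mem_periodicPts_of_comp {α : Type*} [Finite α] {f g : α → α}
    (h : Function.Commute f g) {x : α} (hx : x ∈ Function.periodicPts (f ∘ g)) :
    x ∈ Function.periodicPts f := by
  obtain ⟨n, hn, hnx⟩ := hx
  obtain ⟨i, j, hij, he⟩ : ∃ i j : ℕ, i < j ∧ f^[i] x = f^[j] x := by
    obtain ⟨i, j, hne, he⟩ := Finite.exists_ne_map_eq_of_infinite fun k : ℕ => f^[k] x
    rcases lt_or_gt_of_ne hne with hlt | hlt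
    · exact ⟨i, j, hlt, he⟩
    · exact ⟨j, i, hlt, he.symm⟩
  have hcomp : Function.Commute f (f ∘ g) := (Function.Commute.refl f).comp_right h
  have hper : Function.IsPeriodicPt f (j - i) ((f ∘ g)^[i] x) := by
    change f^[j - i] ((f ∘ g)^[i] x) = (f ∘ g)^[i] x
    rw [h.comp_iterate, ← (h.symm.iterate_iterate i i).comp_eq]
    simp only [Function.comp_apply]
    rw [(h.iterate_iterate (j - i) i).eq, ← Function.iterate_add_apply,
      Nat.sub_add_cancel hij.le, he]
  have hback : (f ∘ g)^[n * i - i] ((f ∘ g)^[i] x) = x := by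
    rw [← Function.iterate_add_apply, Nat.sub_add_cancel (Nat.le_mul_of_pos_left i hn)]
    exact hnx.mul_const i
  refine ⟨j - i, Nat.sub_pos_of_lt hij, ?_⟩
  rw [← hback]
  exact hper.map (hcomp.symm.iterate_left (n * i - i))

/-- A self-map that restricts to an injection of a finite set into itself has every point of the
set periodic. -/
theorem Set.MapsTo.mem_periodicPts {α : Type*} {f : α → α} {s : Set α} (hs : s.Finite)
    (hm : Set.MapsTo f s s) (hi : Set.InjOn f s) {x : α} (hx : x ∈ s) :
    x ∈ Function.periodicPts f := by
  have := hs.to_subtype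
  obtain ⟨n, hn, hnx⟩ := (hm.restrict_inj.2 hi).mem_periodicPts ⟨x, hx⟩
  exact ⟨n, hn, hnx.map (g := Subtype.val) fun _ => rfl⟩


/-- if two commuting self-maps of a finite set compose to a non-trivial
permutation of a subset P, then some iterate of one of them is a non-trivial
permutation of some subset P'. -/
theorem stmt_3 {Q : Type} [Fintype Q] (π₁ π₂ : Q → Q)
    (hcomm : ∀ q : Q, π₁ (π₂ q) = π₂ (π₁ q))
    (P : Set Q)
    (hbij : Set.BijOn (fun q => π₂ (π₁ q)) P P)
    (hnt : ¬ Set.EqOn (fun q => π₂ (π₁ q)) id P) :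
    ∃ (P' : Set Q) (d : ℕ), 1 ≤ d ∧
      ((Set.BijOn (π₁^[d]) P' P' ∧ ¬ Set.EqOn (π₁^[d]) id P') ∨
       (Set.BijOn (π₂^[d]) P' P' ∧ ¬ Set.EqOn (π₂^[d]) id P')) := by
  have h : Function.Commute π₁ π₂ := hcomm
  simp only [Set.EqOn, not_forall] at hnt
  obtain ⟨p, hp, hne⟩ := hnt
  have hper : p ∈ Function.periodicPts (π₂ ∘ π₁) :=
    hbij.mapsTo.mem_periodicPts P.toFinite hbij.injOn hp
  have h₂ := h.symm.mem_periodicPts_of_comp hper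
  have h₁ : p ∈ Function.periodicPts π₁ := h.mem_periodicPts_of_comp (h.comp_eq ▸ hper)
  by_cases hfix : π₁ p = p
  · refine ⟨Function.periodicPts π₂, 1, le_rfl, Or.inr
      ⟨Function.bijOn_periodicPts π₂, fun heq => hne ?_⟩⟩
    simpa [hfix] using heq h₂
  · exact ⟨Function.periodicPts π₁, 1, le_rfl, Or.inl
      ⟨Function.bijOn_periodicPts π₁, fun heq => hfix (heq h₁)⟩⟩
end

section
/- Let A=(Q,Σ,·,∘,q₀,F) be a minimal biautomaton. Then all states in Q are pairwise almost-equivalent if and only if the language L(A) is finite or co-finite. -/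
/-- Two languages are almost-equivalent if their symmetric difference is finite. -/
def AlmostEq {α : Type} (L₁ L₂ : Set (List α)) : Prop :=
  ((L₁ \ L₂) ∪ (L₂ \ L₁)).Finite

/-- The right language of a state of a biautomaton. -/
def DBiA.rightLang {α Q : Type} (A : DBiA α Q) (q : Q) : Set (List α) :=
  {w | A.fwdW q w ∈ A.accept}

namespace DBiA

variable {α Q : Type}

theorem fwdW_bwd (A : DBiA α Q) (q : Q) (a : α) (w : List α) :
    A.fwdW (A.bwd q a) w = A.bwd (A.fwdW q w) a := by
  induction w generalizing q with
  | nil => rfl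
  | cons b w ih =>
    change A.fwdW (A.fwd (A.bwd q a) b) w = A.bwd (A.fwdW (A.fwd q b) w) a
    rw [← A.diamond, ih]

theorem mem_rightLang_fwdW (A : DBiA α Q) (q : Q) (u w : List α) :
    w ∈ A.rightLang (A.fwdW q u) ↔ u ++ w ∈ A.rightLang q := by
  simp [rightLang, fwdW]

theorem mem_rightLang_bwd (A : DBiA α Q) (q : Q) (a : α) (w : List α) :
    w ∈ A.rightLang (A.bwd q a) ↔ w ++ [a] ∈ A.rightLang q := by
  change A.fwdW (A.bwd q a) w ∈ A.accept ↔ A.fwdW q (w ++ [a]) ∈ A.accept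
  rw [fwdW_bwd, ← A.fprop]
  simp [fwdW]

/-- The restriction of a biautomaton to a set of states closed under both transition functions. -/
def restrict (A : DBiA α Q) (P : Q → Prop) (h₀ : P A.start)
    (hf : ∀ q a, P q → P (A.fwd q a)) (hb : ∀ q a, P q → P (A.bwd q a)) :
    DBiA α {q // P q} where
  fwd q a := ⟨A.fwd q a, hf q a q.2⟩
  bwd q a := ⟨A.bwd q a, hb q a q.2⟩
  start := ⟨A.start, h₀⟩
  accept := {q | (q : Q) ∈ A.accept}
  diamond q a b := Subtype.ext (A.diamond q a b)
  fprop q a := A.fprop q a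

theorem coe_fwdW_restrict (A : DBiA α Q) (P : Q → Prop) (h₀ : P A.start)
    (hf : ∀ q a, P q → P (A.fwd q a)) (hb : ∀ q a, P q → P (A.bwd q a))
    (q : {q // P q}) (w : List α) :
    ((A.restrict P h₀ hf hb).fwdW q w : Q) = A.fwdW q w := by
  induction w generalizing q with
  | nil => rfl
  | cons a w ih => exact ih _

/-- A property of the initial state preserved by both transition functions holds at every state
of a minimal biautomaton. -/
theorem forall_of_minimal [Fintype Q] (A : DBiA α Q)
    (hmin : ∀ (Q' : Type) [Fintype Q'], ∀ B : DBiA α Q',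
      B.lang = A.lang → Fintype.card Q ≤ Fintype.card Q')
    (P : Q → Prop) (h₀ : P A.start)
    (hf : ∀ q a, P q → P (A.fwd q a)) (hb : ∀ q a, P q → P (A.bwd q a)) (q : Q) : P q := by
  classical
  by_contra hq
  refine (Fintype.card_subtype_lt hq).not_ge (hmin _ (A.restrict P h₀ hf hb) ?_)
  ext w
  change ((A.restrict P h₀ hf hb).fwdW _ w : Q) ∈ A.accept ↔ _
  rw [coe_fwdW_restrict]
  rfl

theorem finite_rightLang_fwd (A : DBiA α Q) (q : Q) (a : α) (h : (A.rightLang q).Finite) :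
    (A.rightLang (A.fwd q a)).Finite :=
  Set.Finite.preimage (f := List.cons a) List.cons_injective.injOn h

theorem finite_rightLang_bwd (A : DBiA α Q) (q : Q) (a : α) (h : (A.rightLang q).Finite) :
    (A.rightLang (A.bwd q a)).Finite :=
  (h.preimage (List.append_left_injective [a]).injOn).subset
    fun w hw => (A.mem_rightLang_bwd q a w).1 hw

theorem finite_compl_rightLang_fwd (A : DBiA α Q) (q : Q) (a : α)
    (h : (A.rightLang q)ᶜ.Finite) : (A.rightLang (A.fwd q a))ᶜ.Finite :=
  Set.Finite.preimage (f := List.cons a) List.cons_injective.injOn h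

theorem finite_compl_rightLang_bwd (A : DBiA α Q) (q : Q) (a : α)
    (h : (A.rightLang q)ᶜ.Finite) : (A.rightLang (A.bwd q a))ᶜ.Finite :=
  (h.preimage (List.append_left_injective [a]).injOn).subset
    fun w hw hw' => hw ((A.mem_rightLang_bwd q a w).2 hw')

theorem exists_length_bound [Finite Q] (A : DBiA α Q)
    (h : ∀ p q : Q, AlmostEq (A.rightLang p) (A.rightLang q)) :
    ∃ N, ∀ w : List α, N ≤ w.length → ∀ p q, w ∈ A.rightLang p ↔ w ∈ A.rightLang q := by
  have hD := Set.finite_iUnion fun p => Set.finite_iUnion fun q => h p q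
  obtain ⟨N, hN⟩ := (hD.image List.length).bddAbove
  refine ⟨N + 1, fun w hw p q => ?_⟩
  by_contra hpq
  have hle : w.length ≤ N := hN ⟨w, by
    simp only [Set.mem_iUnion]
    refine ⟨p, q, ?_⟩
    simp only [Set.mem_union, Set.mem_sdiff]
    tauto, rfl⟩
  omega

theorem finite_or_finite_compl_lang [Finite Q] (A : DBiA α Q)
    (h : ∀ p q : Q, AlmostEq (A.rightLang p) (A.rightLang q)) :
    A.lang.Finite ∨ A.langᶜ.Finite := by
  obtain ⟨N, hN⟩ := A.exists_length_bound h
  have append_iff_left (u v : List α) (hu : N ≤ u.length) : u ++ v ∈ A.lang ↔ u ∈ A.lang := by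
    induction v using List.reverseRecOn with
    | nil => simp
    | append_singleton v a ih =>
      rw [← ih, ← List.append_assoc]
      exact (A.mem_rightLang_bwd A.start a _).symm.trans
        (hN _ (by rw [List.length_append]; omega) _ _)
  rcases isEmpty_or_nonempty α with hα | ⟨⟨a⟩⟩
  · exact .inl (Set.toFinite _)
  have hu : N ≤ (List.replicate N a).length := by simp
  generalize List.replicate N a = u at hu
  have hmem (w : List α) : w ∈ A.rightLang (A.fwdW A.start u) ↔ u ∈ A.lang :=
    (A.mem_rightLang_fwdW A.start u w).trans (append_iff_left u w hu)
  have hfin := h A.start (A.fwdW A.start u)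
  by_cases huL : u ∈ A.lang
  · exact .inr (hfin.subset fun w hw => .inr ⟨(hmem w).2 huL, hw⟩)
  · exact .inl (hfin.subset fun w hw => .inl ⟨hw, fun hw' => huL ((hmem w).1 hw')⟩)

end DBiA

/-- in a minimal biautomaton, all states are pairwise almost-equivalent
iff the accepted language is finite or co-finite. -/
theorem stmt_9 {α Q : Type} [Fintype Q] (A : DBiA α Q)
    (hmin : ∀ (Q' : Type) [Fintype Q'], ∀ B : DBiA α Q',
      B.lang = A.lang → Fintype.card Q ≤ Fintype.card Q') :
    (∀ p q : Q, AlmostEq (A.rightLang p) (A.rightLang q)) ↔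
    (A.lang.Finite ∨ A.langᶜ.Finite) := by
  refine ⟨A.finite_or_finite_compl_lang, ?_⟩
  rintro (h | h) p q
  · have hall := A.forall_of_minimal hmin (fun q => (A.rightLang q).Finite) h
      A.finite_rightLang_fwd A.finite_rightLang_bwd
    exact (hall p).sdiff.union (hall q).sdiff
  · have hall := A.forall_of_minimal hmin (fun q => (A.rightLang q)ᶜ.Finite) h
      A.finite_compl_rightLang_fwd A.finite_compl_rightLang_bwd
    exact ((hall q).subset fun _ hw => hw.2).union ((hall p).subset fun _ hw => hw.2)
end

section
/- Let Σ={a,b}. No ordered biautomaton accepts the language Σ*abΣ* (the set of all words over {a,b} containing ab as a factor). Consequently, the class of bi-ordered languages is strictly contained in the class of ordered languages. -/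
/-- A biautomaton is ordered if some total order on its states is compatible with
both transition functions. -/
def DBiA.IsOrdered {α Q : Type} (A : DBiA α Q) : Prop :=
  ∃ r : Q → Q → Prop, IsLinearOrder Q r ∧
    ∀ p q : Q, ∀ a : α, r p q → r (A.fwd p a) (A.fwd q a) ∧ r (A.bwd p a) (A.bwd q a)

/-- A DFA is ordered if some total order on its states is compatible with the
transition function. -/
def DFA.IsOrdered {α Q : Type} (A : DFA α Q) : Prop :=
  ∃ r : Q → Q → Prop, IsLinearOrder Q r ∧
    ∀ p q : Q, ∀ a : α, r p q → r (A.step p a) (A.step q a)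

/-- Some positive iterate of a self-map of a finite type is idempotent. -/
theorem exists_iterate_idempotent {Q : Type} [Finite Q] (f : Q → Q) :
    ∃ n, 0 < n ∧ ∀ q, f^[n] (f^[n] q) = f^[n] q := by
  obtain ⟨i, j, hij, h⟩ := Set.finite_univ.exists_lt_map_eq_of_forall_mem
    (f := fun n : ℕ => f^[n]) (fun _ => Set.mem_univ _)
  obtain ⟨d, rfl⟩ := Nat.exists_eq_add_of_lt hij
  have periodic : ∀ m k, i ≤ m → f^[m + k * (d + 1)] = f^[m] := by
    intro m k hm
    induction k with
    | zero => simp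
    | succ k ih =>
      rw [← ih]
      have hm' : m + (k + 1) * (d + 1) = (m + k * (d + 1) - i) + (i + d + 1) := by
        rw [add_mul]; omega
      have hm'' : m + k * (d + 1) = (m + k * (d + 1) - i) + i := by omega
      rw [hm', Function.iterate_add, ← h, ← Function.iterate_add, ← hm'']
  refine ⟨(i + 1) * (d + 1), by positivity, fun q => ?_⟩
  rw [← Function.iterate_add_apply, periodic _ _ (by nlinarith)]

/-- Commuting monotone idempotents `f`, `g` on a linear order satisfy `f (g s) = f s` or
`f (g s) = g s` for every `s`. -/
theorem commuting_idempotent_apply_eq {Q : Type} {r : Q → Q → Prop} (hr : IsLinearOrder Q r)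
    {f g : Q → Q} (hf : ∀ p q, r p q → r (f p) (f q)) (hg : ∀ p q, r p q → r (g p) (g q))
    (hff : ∀ q, f (f q) = f q) (hgg : ∀ q, g (g q) = g q) (hfg : ∀ q, f (g q) = g (f q))
    (s : Q) : f (g s) = f s ∨ f (g s) = g s := by
  have antisymm : ∀ {p q}, r p q → r q p → p = q := fun h₁ h₂ => hr.antisymm _ _ h₁ h₂
  have hgfg : g (f (g s)) = f (g s) := by rw [← hfg, hgg]
  rcases hr.total (f s) (g s) with h | h <;>
  rcases hr.total s (f (g s)) with h' | h' <;>
  · have h₁ := hf _ _ h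
    have h₂ := hg _ _ h
    have h₃ := hf _ _ h'
    have h₄ := hg _ _ h'
    rw [hff] at h₁ h₃
    rw [hgg, ← hfg] at h₂
    rw [hgfg] at h₄
    first
      | exact Or.inl (antisymm ‹_› ‹_›)
      | exact Or.inr (antisymm ‹_› ‹_›)

theorem relation_iterate {Q : Type} {r : Q → Q → Prop} {f : Q → Q}
    (hf : ∀ p q, r p q → r (f p) (f q)) (n : ℕ) :
    ∀ p q, r p q → r (f^[n] p) (f^[n] q) := by
  induction n with
  | zero => exact fun _ _ h => h
  | succ n ih => exact fun p q h => ih _ _ (hf p q h)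

namespace DBiA

variable {α Q : Type} (A : DBiA α Q)

theorem bwdW_fwd (q : Q) (a : α) (w : List α) :
    A.bwdW (A.fwd q a) w = A.fwd (A.bwdW q w) a := by
  induction w with
  | nil => rfl
  | cons b w ih =>
    change A.bwd (A.bwdW (A.fwd q a) w) b = A.fwd (A.bwd (A.bwdW q w) b) a
    rw [ih, A.diamond]

theorem bwdW_mem_accept_iff (q : Q) (w : List α) :
    A.bwdW q w ∈ A.accept ↔ A.fwdW q w ∈ A.accept := by
  induction w generalizing q with
  | nil => rfl
  | cons a w ih =>
    change A.bwd (A.bwdW q w) a ∈ A.accept ↔ A.fwdW (A.fwd q a) w ∈ A.accept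
    rw [← A.fprop, ← ih, A.bwdW_fwd]

theorem fwdW_replicate (q : Q) (a : α) (n : ℕ) :
    A.fwdW q (List.replicate n a) = (fun p => A.fwd p a)^[n] q := by
  induction n generalizing q with
  | zero => rfl
  | succ n ih => exact ih _

theorem bwdW_replicate (q : Q) (a : α) (n : ℕ) :
    A.bwdW q (List.replicate n a) = (fun p => A.bwd p a)^[n] q := by
  induction n with
  | zero => rfl
  | succ n ih =>
    rw [Function.iterate_succ_apply', ← ih]
    rfl

/-- In the language of an ordered finite biautomaton, for any letters `a`, `b` some word `aᵐbⁿ`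
with `m, n > 0` has the same membership status as `aᵐ` or as `bⁿ`. -/
theorem IsOrdered.exists_replicate_append_mem_iff [Finite Q] {A : DBiA α Q} (hA : A.IsOrdered)
    (a b : α) : ∃ m n, 0 < m ∧ 0 < n ∧
      ((List.replicate m a ++ List.replicate n b ∈ A.lang ↔ List.replicate m a ∈ A.lang) ∨
        (List.replicate m a ++ List.replicate n b ∈ A.lang ↔ List.replicate n b ∈ A.lang)) := by
  obtain ⟨r, hr, hmono⟩ := hA
  obtain ⟨m, hm, hff⟩ := exists_iterate_idempotent (fun p => A.fwd p a)
  obtain ⟨n, hn, hgg⟩ := exists_iterate_idempotent (fun p => A.bwd p b)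
  have hfg : Function.Commute (fun p => A.fwd p a) (fun p => A.bwd p b) :=
    fun q => (A.diamond q a b).symm
  have hcomm := (hfg.iterate_left m).iterate_right n
  have happend : List.replicate m a ++ List.replicate n b ∈ A.lang ↔
      (fun p => A.fwd p a)^[m] ((fun p => A.bwd p b)^[n] A.start) ∈ A.accept := by
    rw [hcomm, ← A.bwdW_replicate, A.bwdW_mem_accept_iff, ← A.fwdW_replicate, fwdW, fwdW,
      ← List.foldl_append]
    rfl
  have ha : List.replicate m a ∈ A.lang ↔ (fun p => A.fwd p a)^[m] A.start ∈ A.accept := by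
    rw [← A.fwdW_replicate]
    rfl
  have hb : List.replicate n b ∈ A.lang ↔ (fun p => A.bwd p b)^[n] A.start ∈ A.accept := by
    rw [← A.bwdW_replicate, A.bwdW_mem_accept_iff]
    rfl
  refine ⟨m, n, hm, hn, ?_⟩
  rw [happend, ha, hb]
  exact (commuting_idempotent_apply_eq hr (relation_iterate (fun p q h => (hmono p q a h).1) m)
    (relation_iterate (fun p q h => (hmono p q b h).2) n) hff hgg hcomm A.start).imp
    (fun h => by rw [h]) (fun h => by rw [h])

end DBiA

/-- The words over `{a, b}` with factor `ab`, where `a = true` and `b = false`. -/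
def factorAB : Set (List Bool) :=
  {w | ∃ x y : List Bool, w = x ++ [true, false] ++ y}

theorem mem_factorAB {w : List Bool} : w ∈ factorAB ↔ [true, false] <:+: w :=
  exists_congr fun _ => exists_congr fun _ => eq_comm

theorem not_isOrdered_of_lang_eq_factorAB {Q : Type} [Finite Q] {B : DBiA Bool Q}
    (hL : B.lang = factorAB) : ¬ B.IsOrdered := by
  intro hB
  obtain ⟨m, n, hm, hn, h⟩ := hB.exists_replicate_append_mem_iff true false
  simp only [hL, mem_factorAB] at h
  have hmn : [true, false] <:+: List.replicate m true ++ List.replicate n false := by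
    obtain ⟨m, rfl⟩ := Nat.exists_eq_add_of_lt hm
    obtain ⟨n, rfl⟩ := Nat.exists_eq_add_of_lt hn
    refine ⟨List.replicate m true, List.replicate n false, ?_⟩
    rw [List.replicate_succ' (a := true), List.replicate_succ (a := false)]
    simp
  rcases h with h | h
  · have := List.eq_of_mem_replicate ((h.1 hmn).subset (show false ∈ _ by simp))
    contradiction
  · have := List.eq_of_mem_replicate ((h.1 hmn).subset (show true ∈ _ by simp))
    contradiction

/-- The three-state automaton for `factorAB`: state `1` has just read `a`, state `2` has
seen `ab`. -/
def factorABDFA : DFA Bool (Fin 3) where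
  step q c := if c then max q 1 else if q = 0 then 0 else 2
  start := 0
  accept := {2}

theorem factorABDFA_isOrdered : factorABDFA.IsOrdered := by
  refine ⟨(· ≤ ·), inferInstance, ?_⟩
  simp only [factorABDFA]
  decide

theorem factorABDFA_evalFrom_eq_two_iff (w : List Bool) :
    factorABDFA.evalFrom 2 w = 2 ∧
      (factorABDFA.evalFrom 1 w = 2 ↔ [true, false] <:+: true :: w) ∧
      (factorABDFA.evalFrom 0 w = 2 ↔ [true, false] <:+: w) := by
  induction w with
  | nil => simp [List.infix_cons_iff]
  | cons c w ih =>
    obtain ⟨h₂, h₁, h₀⟩ := ih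
    have step_true : ∀ q, factorABDFA.step q true = max q 1 := fun _ => rfl
    have step_false : ∀ q, factorABDFA.step q false = if q = 0 then 0 else 2 := fun _ => rfl
    cases c
    · simp [DFA.evalFrom_cons, step_false, h₂, h₀, List.infix_cons_iff]
    · simp [DFA.evalFrom_cons, step_true, h₂, h₁, List.infix_cons_iff]

theorem factorABDFA_accepts : factorABDFA.accepts = factorAB :=
  Set.ext fun w => (factorABDFA_evalFrom_eq_two_iff w).2.2.trans mem_factorAB.symm

/-- no ordered biautomaton accepts Σ*abΣ* over Σ = {a, b} (here a = true
and b = false), and consequently the class of bi-ordered languages is strictly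
contained in the class of ordered languages. -/
theorem stmt_13 :
    (¬ ∃ (Q : Type) (_ : Fintype Q) (B : DBiA Bool Q), B.IsOrdered ∧
        B.lang = {w : List Bool | ∃ x y : List Bool, w = x ++ [true, false] ++ y}) ∧
    (∃ L : Set (List Bool),
      (∃ (Q : Type) (_ : Fintype Q) (A : DFA Bool Q), A.IsOrdered ∧ A.accepts = L) ∧
      ¬ ∃ (Q : Type) (_ : Fintype Q) (B : DBiA Bool Q), B.IsOrdered ∧ B.lang = L) := by
  have h : ¬ ∃ (Q : Type) (_ : Fintype Q) (B : DBiA Bool Q), B.IsOrdered ∧ B.lang = factorAB :=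
    fun ⟨_, _, _, hB, hL⟩ => not_isOrdered_of_lang_eq_factorAB hL hB
  exact ⟨h, factorAB, ⟨Fin 3, inferInstance, factorABDFA, factorABDFA_isOrdered,
    factorABDFA_accepts⟩, h⟩
end

section
/- Every finite language and every co-finite language over an alphabet Σ is accepted by some ordered biautomaton. -/
/-- The bijective base-`k` value of a word of digits, least significant digit first. -/
def digitCode {k : ℕ} : List (Fin k) → ℕ
  | [] => 0
  | a :: l => digitCode l * k + a + 1

theorem digitCode_injective {k : ℕ} : Function.Injective (digitCode (k := k)) := by
  intro l
  induction l with
  | nil =>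
    rintro (_ | ⟨b, m⟩) h
    · rfl
    · simp [digitCode] at h
  | cons a l ih =>
    rintro (_ | ⟨b, m⟩) h
    · simp [digitCode] at h
    · have h' : (a : ℕ) + k * digitCode l = b + k * digitCode m := by
        simp only [digitCode] at h
        linarith
      have hab : (a : ℕ) = b := by
        have := congrArg (· % k) h'
        simpa [Nat.add_mul_mod_self_left, Nat.mod_eq_of_lt a.2, Nat.mod_eq_of_lt b.2] using this
      have hlm : digitCode l = digitCode m :=
        Nat.eq_of_mul_eq_mul_left (Nat.pos_of_ne_zero (fun hk => by
          subst hk; exact a.elim0)) (by omega : k * digitCode l = k * digitCode m)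
      rw [Fin.ext hab, ih hlm]

theorem digitCode_cons_lt_cons {k : ℕ} (a : Fin k) {l m : List (Fin k)}
    (h : digitCode l < digitCode m) : digitCode (a :: l) < digitCode (a :: m) := by
  have hk : 0 < k := a.pos
  have := Nat.mul_lt_mul_of_pos_right h hk
  simp only [digitCode]
  omega

theorem digitCode_cons_le_cons {k : ℕ} (a : Fin k) {l m : List (Fin k)}
    (h : digitCode l ≤ digitCode m) : digitCode (a :: l) ≤ digitCode (a :: m) := by
  have := Nat.mul_le_mul_right k h
  simp only [digitCode]
  omega

/-- Pairs of words (the prefix and the suffix read so far) of total length at most `N`, together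
with a sink `none`. -/
abbrev TruncState (α : Type) (N : ℕ) : Type :=
  Option {p : List α × List α // p.1.length + p.2.length ≤ N}

namespace TruncState

variable {α : Type} {N : ℕ}

instance [Finite α] : Finite (TruncState α N) := by
  have h : {p : List α × List α | p.1.length + p.2.length ≤ N}.Finite := by
    refine ((List.finite_length_le α N).prod (List.finite_length_le α N)).subset ?_
    intro p hp
    simp only [Set.mem_ofPred_eq, Set.mem_prod] at hp ⊢
    omega
  have : Finite {p : List α × List α // p.1.length + p.2.length ≤ N} := h
  infer_instance

/-- The state in which prefix `x` and suffix `y` have been read. -/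
def mk (N : ℕ) (x y : List α) : TruncState α N :=
  if h : x.length + y.length ≤ N then some ⟨(x, y), h⟩ else none

theorem mk_of_le {x y : List α} (h : x.length + y.length ≤ N) :
    mk N x y = some ⟨(x, y), h⟩ := dif_pos h

theorem mk_of_lt {x y : List α} (h : N < x.length + y.length) : mk N x y = none :=
  dif_neg (by omega)

/-- Extend the prefix by a letter. -/
def snocLeft : TruncState α N → α → TruncState α N
  | none, _ => none
  | some p, a => mk N (p.1.1 ++ [a]) p.1.2

/-- Extend the suffix by a letter. -/
def consRight : TruncState α N → α → TruncState α N
  | none, _ => none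
  | some p, a => mk N p.1.1 (a :: p.1.2)

theorem snocLeft_mk (x y : List α) (a : α) : snocLeft (mk N x y) a = mk N (x ++ [a]) y := by
  rcases le_or_gt (x.length + y.length) N with h | h
  · rw [mk_of_le h, snocLeft]
  · rw [mk_of_lt h, mk_of_lt (by simp; omega), snocLeft]

theorem consRight_mk (x y : List α) (a : α) : consRight (mk N x y) a = mk N x (a :: y) := by
  rcases le_or_gt (x.length + y.length) N with h | h
  · rw [mk_of_le h, consRight]
  · rw [mk_of_lt h, mk_of_lt (by simp; omega), consRight]

theorem foldl_snocLeft_mk (x y w : List α) :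
    w.foldl snocLeft (mk N x y) = mk N (x ++ w) y := by
  induction w generalizing x with
  | nil => simp
  | cons a w ih => rw [List.foldl_cons, snocLeft_mk, ih, List.append_assoc, List.singleton_append]

/-- The states accepting `L`, given that the sink is accepting if and only if `c` holds. -/
def acceptSet (L : Set (List α)) (c : Prop) : Set (TruncState α N) :=
  {q | q.elim c fun p => p.1.1 ++ p.1.2 ∈ L}

theorem mk_mem_acceptSet {L : Set (List α)} {c : Prop}
    (hL : ∀ w : List α, N < w.length → (w ∈ L ↔ c)) (x y : List α) :
    mk N x y ∈ acceptSet L c ↔ x ++ y ∈ L := by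
  rcases le_or_gt (x.length + y.length) N with h | h
  · rw [mk_of_le h]
    rfl
  · rw [mk_of_lt h, hL _ (by simpa using h)]
    rfl

/-- States are compared by total length, then by prefix, then by suffix; the sink is greatest. -/
noncomputable def key [Fintype α] : TruncState α N → WithTop (ℕ ×ₗ ℕ ×ₗ ℕ)
  | none => ⊤
  | some p => (toLex (p.1.1.length + p.1.2.length,
      toLex (digitCode (p.1.1.reverse.map (Fintype.equivFin α)),
        digitCode (p.1.2.map (Fintype.equivFin α)))) : ℕ ×ₗ ℕ ×ₗ ℕ)

theorem key_injective [Fintype α] : Function.Injective (key (α := α) (N := N)) := by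
  have hmap : Function.Injective (List.map (Fintype.equivFin α)) :=
    List.map_injective_iff.2 (Fintype.equivFin α).injective
  rintro (_ | ⟨⟨x, y⟩, hp⟩) (_ | ⟨⟨z, w⟩, hq⟩) h
  · rfl
  · simp [key] at h
  · simp [key] at h
  · simp only [key, WithTop.coe_inj, toLex_inj, Prod.mk.injEq] at h
    obtain rfl := List.reverse_injective (hmap (digitCode_injective h.2.1))
    obtain rfl := hmap (digitCode_injective h.2.2)
    rfl

theorem key_snocLeft_le [Fintype α] {p q : TruncState α N} (a : α) (h : key p ≤ key q) :
    key (snocLeft p a) ≤ key (snocLeft q a) := by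
  obtain _ | ⟨⟨z, w⟩, hq⟩ := q
  · exact le_top
  obtain _ | ⟨⟨x, y⟩, hp⟩ := p
  · simp [key] at h
  simp only [key, WithTop.coe_le_coe, Prod.Lex.toLex_le_toLex] at h
  simp only [snocLeft]
  rcases le_or_gt ((z ++ [a]).length + w.length) N with hz | hz
  · have hx : (x ++ [a]).length + y.length ≤ N := by simp at hz ⊢; omega
    rw [mk_of_le hz, mk_of_le hx]
    simp only [key, WithTop.coe_le_coe, Prod.Lex.toLex_le_toLex, List.length_append,
      List.length_singleton, List.reverse_append, List.reverse_singleton, List.singleton_append,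
      List.map_cons]
    rcases h with h | ⟨h, h' | ⟨h', h''⟩⟩
    · left; omega
    · exact Or.inr ⟨by omega, Or.inl (digitCode_cons_lt_cons _ h')⟩
    · exact Or.inr ⟨by omega, Or.inr ⟨by rw [digitCode_injective h'], h''⟩⟩
  · rw [mk_of_lt hz]
    exact le_top

theorem key_consRight_le [Fintype α] {p q : TruncState α N} (a : α) (h : key p ≤ key q) :
    key (consRight p a) ≤ key (consRight q a) := by
  obtain _ | ⟨⟨z, w⟩, hq⟩ := q
  · exact le_top
  obtain _ | ⟨⟨x, y⟩, hp⟩ := p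
  · simp [key] at h
  simp only [key, WithTop.coe_le_coe, Prod.Lex.toLex_le_toLex] at h
  simp only [consRight]
  rcases le_or_gt (z.length + (a :: w).length) N with hz | hz
  · have hx : x.length + (a :: y).length ≤ N := by simp at hz ⊢; omega
    rw [mk_of_le hz, mk_of_le hx]
    simp only [key, WithTop.coe_le_coe, Prod.Lex.toLex_le_toLex, List.length_cons, List.map_cons]
    rcases h with h | ⟨h, h' | ⟨h', h''⟩⟩
    · left; omega
    · exact Or.inr ⟨by omega, Or.inl h'⟩
    · exact Or.inr ⟨by omega, Or.inr ⟨h', digitCode_cons_le_cons _ h''⟩⟩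
  · rw [mk_of_lt hz]
    exact le_top

/-- The biautomaton on `TruncState α N` accepting a language that is constant beyond
length `N`. -/
def biautomaton (L : Set (List α)) (c : Prop)
    (hL : ∀ w : List α, N < w.length → (w ∈ L ↔ c)) : DBiA α (TruncState α N) where
  fwd := snocLeft
  bwd := consRight
  start := mk N [] []
  accept := acceptSet L c
  diamond := by
    rintro (_ | ⟨⟨x, y⟩, h⟩) a b
    · rfl
    · rw [← mk_of_le h, snocLeft_mk, consRight_mk, consRight_mk, snocLeft_mk]
  fprop := by
    rintro (_ | ⟨⟨x, y⟩, h⟩) a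
    · rfl
    · rw [← mk_of_le h, snocLeft_mk, consRight_mk, mk_mem_acceptSet hL, mk_mem_acceptSet hL,
        List.append_assoc, List.singleton_append]

theorem lang_biautomaton (L : Set (List α)) (c : Prop)
    (hL : ∀ w : List α, N < w.length → (w ∈ L ↔ c)) : (biautomaton L c hL).lang = L := by
  ext w
  change w.foldl snocLeft (mk N [] []) ∈ acceptSet L c ↔ w ∈ L
  rw [foldl_snocLeft_mk, mk_mem_acceptSet hL, List.nil_append, List.append_nil]

theorem isOrdered_biautomaton [Fintype α] (L : Set (List α)) (c : Prop)
    (hL : ∀ w : List α, N < w.length → (w ∈ L ↔ c)) : (biautomaton L c hL).IsOrdered :=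
  ⟨fun p q => key p ≤ key q,
    { refl := fun _ => le_rfl
      trans := fun _ _ _ => le_trans
      antisymm := fun _ _ h h' => key_injective (le_antisymm h h')
      total := fun _ _ => le_total _ _ },
    fun _ _ a h => ⟨key_snocLeft_le a h, key_consRight_le a h⟩⟩

end TruncState

theorem Set.Finite.exists_length_le {α : Type} {L : Set (List α)} (h : L.Finite) :
    ∃ N, ∀ w ∈ L, w.length ≤ N := by
  obtain ⟨N, hN⟩ := (h.image List.length).bddAbove
  exact ⟨N, fun w hw => hN (Set.mem_image_of_mem _ hw)⟩

/-- every finite and every co-finite language over a finite alphabet is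
accepted by some ordered biautomaton. -/
theorem stmt_14 {α : Type} [Fintype α] (L : Set (List α))
    (h : L.Finite ∨ Lᶜ.Finite) :
    ∃ (Q : Type) (_ : Fintype Q) (B : DBiA α Q), B.IsOrdered ∧ B.lang = L := by
  obtain ⟨N, c, hL⟩ : ∃ (N : ℕ) (c : Prop), ∀ w : List α, N < w.length → (w ∈ L ↔ c) := by
    rcases h with h | h
    · obtain ⟨N, hN⟩ := h.exists_length_le
      exact ⟨N, False, fun w hw => iff_false_intro fun hwL => (hN w hwL).not_gt hw⟩
    · obtain ⟨N, hN⟩ := h.exists_length_le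
      exact ⟨N, True, fun w hw => iff_true_intro (by_contra fun hwL => (hN w hwL).not_gt hw)⟩
  exact ⟨TruncState α N, Fintype.ofFinite _, TruncState.biautomaton L c hL,
    TruncState.isOrdered_biautomaton L c hL, TruncState.lang_biautomaton L c hL⟩
end

section
/- There exists a language that is accepted by an ordered biautomaton but is neither finite nor co-finite; concretely, the language a* ∪ {b} over the alphabet {a,b} is accepted by an ordered biautomaton. Consequently, the class of finite and co-finite languages is strictly contained in the class of bi-ordered languages. -/
/-- The transition function, both forward and backward, of the minimal biautomaton of
`a* ∪ {b}`; the states `3`, `2`, `1`, `0` stand for `a* ∪ {b}`, `a*`, `{λ}` and `∅`. -/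
def starUnionStep (q : Fin 4) (c : Bool) : Fin 4 :=
  if c then ![0, 0, 2, 2] q else ![0, 0, 0, 1] q

/-- The minimal biautomaton of `a* ∪ {b}`. -/
def starUnionDBiA : DBiA Bool (Fin 4) where
  fwd := starUnionStep
  bwd := starUnionStep
  start := 3
  accept := {q | q ≠ 0}
  diamond := by decide
  fprop _ _ := Iff.rfl

theorem starUnionDBiA_isOrdered : starUnionDBiA.IsOrdered := by
  have step_mono : ∀ p q : Fin 4, ∀ c, p ≤ q → starUnionStep p c ≤ starUnionStep q c := by
    decide
  exact ⟨(· ≤ ·), inferInstance, fun p q c h => ⟨step_mono p q c h, step_mono p q c h⟩⟩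

theorem foldl_starUnionStep_zero (w : List Bool) : w.foldl starUnionStep 0 = 0 := by
  induction w with
  | nil => rfl
  | cons c w ih => cases c <;> exact ih

theorem foldl_starUnionStep_one (w : List Bool) :
    w.foldl starUnionStep 1 ≠ 0 ↔ w = [] := by
  cases w with
  | nil => simp
  | cons c w => cases c <;> simpa [starUnionStep] using foldl_starUnionStep_zero w

theorem foldl_starUnionStep_two (w : List Bool) :
    w.foldl starUnionStep 2 ≠ 0 ↔ ∀ c ∈ w, c = true := by
  induction w with
  | nil => simp
  | cons c w ih =>
    cases c
    · simpa [starUnionStep] using foldl_starUnionStep_zero w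
    · simpa [starUnionStep] using ih

theorem foldl_starUnionStep_three (w : List Bool) :
    w.foldl starUnionStep 3 ≠ 0 ↔ (∀ c ∈ w, c = true) ∨ w = [false] := by
  cases w with
  | nil => simp
  | cons c w =>
    cases c
    · simpa [starUnionStep] using foldl_starUnionStep_one w
    · simpa [starUnionStep] using foldl_starUnionStep_two w

theorem starUnionDBiA_lang :
    starUnionDBiA.lang = ({w : List Bool | ∀ c ∈ w, c = true} ∪ {[false]}) :=
  Set.ext foldl_starUnionStep_three

/-- the language a* ∪ {b} over {a, b} (a = true, b = false) is accepted
by an ordered biautomaton, yet is neither finite nor co-finite; hence the class of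
finite and co-finite languages is strictly contained in the bi-ordered languages. -/
theorem stmt_15 :
    (∃ (Q : Type) (_ : Fintype Q) (B : DBiA Bool Q), B.IsOrdered ∧
        B.lang = ({w : List Bool | ∀ c ∈ w, c = true} ∪ {[false]})) ∧
    ¬ ({w : List Bool | ∀ c ∈ w, c = true} ∪ {[false]} : Set (List Bool)).Finite ∧
    ¬ ({w : List Bool | ∀ c ∈ w, c = true} ∪ {[false]} : Set (List Bool))ᶜ.Finite := by
  refine ⟨⟨Fin 4, inferInstance, starUnionDBiA, starUnionDBiA_isOrdered, starUnionDBiA_lang⟩,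
    ?_, ?_⟩
  · refine Set.infinite_of_injective_forall_mem (f := fun n : ℕ => List.replicate n true)
      (List.replicate_left_injective true) fun n => Or.inl fun c hc => ?_
    exact List.eq_of_mem_replicate hc
  · refine Set.infinite_of_injective_forall_mem
      (f := fun n : ℕ => List.replicate (n + 2) false)
      (fun m n h => by simpa using congrArg List.length h) fun n => ?_
    simp [List.replicate_succ]
end

section
/- If the minimal biautomaton for a regular language L is non-returning, then the minimal DFA for L is non-returning. Moreover, the converse fails: for the language ab* over the alphabet {a,b}, the minimal DFA is non-returning, while the minimal biautomaton is returning (its initial state has a backward self-loop on the symbol b). Hence the class of languages whose minimal biautomaton is non-returning is strictly contained in the class of languages whose minimal DFA is non-returning. -/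
/-- A state is a sink state if all its forward and backward transitions are self-loops. -/
def DBiA.IsSink {α Q : Type} (A : DBiA α Q) (s : Q) : Prop :=
  ∀ a : α, A.fwd s a = s ∧ A.bwd s a = s

/-- A biautomaton is non-exiting if every transition leaving an accepting state goes to
a non-accepting sink state. -/
def DBiA.NonExiting {α Q : Type} (A : DBiA α Q) : Prop :=
  ∀ q ∈ A.accept, ∀ a : α,
    (A.fwd q a ∉ A.accept ∧ A.IsSink (A.fwd q a)) ∧
    (A.bwd q a ∉ A.accept ∧ A.IsSink (A.bwd q a))

/-- A biautomaton is non-returning if its initial state has no ingoing transitions. -/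
def DBiA.NonReturning {α Q : Type} (A : DBiA α Q) : Prop :=
  ¬ ∃ (q : Q) (a : α), A.fwd q a = A.start ∨ A.bwd q a = A.start

/-- A DFA is non-returning if its initial state has no ingoing transitions. -/
def DFA.NonReturning {α Q : Type} (A : DFA α Q) : Prop :=
  ¬ ∃ (q : Q) (a : α), A.step q a = A.start

namespace DBiA

variable {α Q : Type}

/-- The language of words accepted when reading forward from the state `q`. -/
def stateLang (B : DBiA α Q) (q : Q) : Set (List α) := {w | B.fwdW q w ∈ B.accept}

theorem fwdW_append (B : DBiA α Q) (q : Q) (u v : List α) :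
    B.fwdW q (u ++ v) = B.fwdW (B.fwdW q u) v :=
  List.foldl_append

theorem mem_stateLang_fwdW (B : DBiA α Q) (q : Q) (u w : List α) :
    w ∈ B.stateLang (B.fwdW q u) ↔ u ++ w ∈ B.stateLang q := by
  simp [stateLang, fwdW_append]

theorem fwdW_bwd_s18 (B : DBiA α Q) (q : Q) (b : α) (w : List α) :
    B.fwdW (B.bwd q b) w = B.bwd (B.fwdW q w) b := by
  induction w generalizing q with
  | nil => rfl
  | cons a w ih =>
    change B.fwdW (B.fwd (B.bwd q b) a) w = B.bwd (B.fwdW (B.fwd q a) w) b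
    rw [← B.diamond, ih]

theorem mem_stateLang_bwd (B : DBiA α Q) (q : Q) (b : α) (w : List α) :
    w ∈ B.stateLang (B.bwd q b) ↔ w ++ [b] ∈ B.stateLang q := by
  change B.fwdW (B.bwd q b) w ∈ B.accept ↔ B.fwdW q (w ++ [b]) ∈ B.accept
  rw [fwdW_bwd_s18, ← B.fprop, fwdW_append]
  rfl

theorem stateLang_fwd_congr (B : DBiA α Q) {p q : Q} (h : B.stateLang p = B.stateLang q) (a : α) :
    B.stateLang (B.fwd p a) = B.stateLang (B.fwd q a) := by
  ext w
  change a :: w ∈ B.stateLang p ↔ a :: w ∈ B.stateLang q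
  rw [h]

theorem stateLang_bwd_congr (B : DBiA α Q) {p q : Q} (h : B.stateLang p = B.stateLang q) (a : α) :
    B.stateLang (B.bwd p a) = B.stateLang (B.bwd q a) := by
  ext w
  rw [mem_stateLang_bwd, mem_stateLang_bwd, h]

theorem mem_accept_congr (B : DBiA α Q) {p q : Q} (h : B.stateLang p = B.stateLang q) :
    p ∈ B.accept ↔ q ∈ B.accept := by
  change [] ∈ B.stateLang p ↔ [] ∈ B.stateLang q
  rw [h]

/-- The biautomaton obtained by identifying states that accept the same language. -/
def mergeEquivalent (B : DBiA α Q) : DBiA α (Quotient (Setoid.ker B.stateLang)) where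
  fwd q a := Quotient.map (B.fwd · a) (fun _ _ h => B.stateLang_fwd_congr h a) q
  bwd q a := Quotient.map (B.bwd · a) (fun _ _ h => B.stateLang_bwd_congr h a) q
  start := Quotient.mk _ B.start
  accept := {q | Quotient.lift (· ∈ B.accept) (fun _ _ h => propext (B.mem_accept_congr h)) q}
  diamond := by
    rintro ⟨q⟩ a b
    exact congrArg (Quotient.mk _) (B.diamond q a b)
  fprop := by
    rintro ⟨q⟩ a
    exact B.fprop q a

theorem mergeEquivalent_fwdW (B : DBiA α Q) (q : Q) (w : List α) :
    B.mergeEquivalent.fwdW (Quotient.mk _ q) w = Quotient.mk _ (B.fwdW q w) := by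
  induction w generalizing q with
  | nil => rfl
  | cons a w ih => exact ih (B.fwd q a)

theorem mergeEquivalent_lang (B : DBiA α Q) : B.mergeEquivalent.lang = B.lang := by
  ext w
  change B.mergeEquivalent.fwdW (Quotient.mk _ B.start) w ∈ B.mergeEquivalent.accept ↔ _
  rw [mergeEquivalent_fwdW]
  rfl

theorem stateLang_injective_of_minimal [Fintype Q] (B : DBiA α Q)
    (hB : ∀ (Q' : Type) [Fintype Q'], ∀ B' : DBiA α Q',
      B'.lang = B.lang → Fintype.card Q ≤ Fintype.card Q') :
    Function.Injective B.stateLang := by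
  classical
  intro p q h
  have hsurj : Function.Surjective (Quotient.mk (Setoid.ker B.stateLang)) := Quotient.mk_surjective
  have hcard := hB _ B.mergeEquivalent B.mergeEquivalent_lang
  rw [← Nat.card_eq_fintype_card, ← Nat.card_eq_fintype_card] at hcard
  exact (hsurj.bijective_of_nat_card_le hcard).1 (Quotient.sound h)

end DBiA

namespace DFA

variable {α Q : Type}

/-- The restriction of a DFA to its reachable states. -/
def reachablePart (A : DFA α Q) : DFA α (Set.range A.eval) where
  step q a := ⟨A.step q a, by
    obtain ⟨_, w, rfl⟩ := q
    exact ⟨w ++ [a], A.eval_append_singleton w a⟩⟩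
  start := ⟨A.start, [], rfl⟩
  accept := {q | (q : Q) ∈ A.accept}

theorem reachablePart_evalFrom (A : DFA α Q) (q : Set.range A.eval) (w : List α) :
    (A.reachablePart.evalFrom q w : Q) = A.evalFrom q w := by
  induction w generalizing q with
  | nil => rfl
  | cons a w ih => exact ih (A.reachablePart.step q a)

theorem reachablePart_accepts (A : DFA α Q) : A.reachablePart.accepts = A.accepts := by
  ext w
  change (A.reachablePart.evalFrom _ w : Q) ∈ A.accept ↔ A.evalFrom A.start w ∈ A.accept
  rw [reachablePart_evalFrom]
  rfl

theorem eval_surjective_of_minimal [Fintype Q] (A : DFA α Q)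
    (hA : ∀ (Q' : Type) [Fintype Q'], ∀ A' : DFA α Q',
      A'.accepts = A.accepts → Fintype.card Q ≤ Fintype.card Q') :
    Function.Surjective A.eval := by
  classical
  intro q
  by_contra hq
  exact (Fintype.card_subtype_lt (p := (· ∈ Set.range A.eval)) hq).not_ge
    (hA _ A.reachablePart A.reachablePart_accepts)

/-- If the initial state of a minimal DFA is re-entered, some nonempty word can be
prepended without affecting membership. -/
theorem exists_append_mem_accepts_iff [Fintype Q] (A : DFA α Q)
    (hA : ∀ (Q' : Type) [Fintype Q'], ∀ A' : DFA α Q',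
      A'.accepts = A.accepts → Fintype.card Q ≤ Fintype.card Q')
    {q : Q} {a : α} (h : A.step q a = A.start) :
    ∃ u : List α, ∀ w, (u ++ [a]) ++ w ∈ A.accepts ↔ w ∈ A.accepts := by
  obtain ⟨u, rfl⟩ := A.eval_surjective_of_minimal hA q
  refine ⟨u, fun w => ?_⟩
  have hu : A.evalFrom A.start (u ++ [a]) = A.start := (A.eval_append_singleton u a).trans h
  rw [mem_accepts, mem_accepts, eval, evalFrom_of_append, hu]

end DFA

/-- if the minimal biautomaton of L is non-returning then so is the
minimal DFA of L; the converse fails for the language ab* over {a, b} (a = true,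
b = false), whose minimal DFA is non-returning while its minimal biautomaton is
returning. -/
theorem stmt_18 :
    (∀ (α Q₁ Q₂ : Type) (_ : Fintype Q₁) (_ : Fintype Q₂)
        (B : DBiA α Q₁) (A : DFA α Q₂),
      (∀ (Q' : Type) [Fintype Q'], ∀ B' : DBiA α Q',
        B'.lang = B.lang → Fintype.card Q₁ ≤ Fintype.card Q') →
      (∀ (Q' : Type) [Fintype Q'], ∀ A' : DFA α Q',
        A'.accepts = A.accepts → Fintype.card Q₂ ≤ Fintype.card Q') →
      A.accepts = B.lang → B.NonReturning → A.NonReturning) ∧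
    (∀ (Q : Type) (_ : Fintype Q) (A : DFA Bool Q),
      (∀ (Q' : Type) [Fintype Q'], ∀ A' : DFA Bool Q',
        A'.accepts = A.accepts → Fintype.card Q ≤ Fintype.card Q') →
      A.accepts = {w : List Bool | ∃ n : ℕ, w = true :: List.replicate n false} →
      A.NonReturning) ∧
    (∀ (Q : Type) (_ : Fintype Q) (B : DBiA Bool Q),
      (∀ (Q' : Type) [Fintype Q'], ∀ B' : DBiA Bool Q',
        B'.lang = B.lang → Fintype.card Q ≤ Fintype.card Q') →
      B.lang = {w : List Bool | ∃ n : ℕ, w = true :: List.replicate n false} →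
      ¬ B.NonReturning) := by
  refine ⟨fun α Q₁ Q₂ _ _ B A hB hA hL hnr => ?_, fun Q _ A hA hL => ?_, fun Q _ B hB hL hnr => ?_⟩
  · rintro ⟨q, a, h⟩
    obtain ⟨u, hu⟩ := A.exists_append_mem_accepts_iff hA h
    refine hnr ⟨B.fwdW B.start u, a, Or.inl (B.stateLang_injective_of_minimal hB ?_)⟩
    ext w
    rw [hL] at hu
    have hw : (u ++ [a]) ++ w ∈ B.stateLang B.start ↔ w ∈ B.stateLang B.start := hu w
    rw [← hw, ← B.mem_stateLang_fwdW, B.fwdW_append]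
    rfl
  · rintro ⟨q, a, h⟩
    obtain ⟨u, hu⟩ := A.exists_append_mem_accepts_iff hA h
    rw [hL] at hu
    obtain ⟨n, hn⟩ := (hu [true]).2 ⟨0, rfl⟩
    cases u with
    | nil =>
      have := congrArg List.tail hn
      simp only [List.nil_append, List.cons_append, List.tail_cons] at this
      have := List.eq_of_mem_replicate (this ▸ List.mem_singleton_self true)
      contradiction
    | cons b u =>
      have := congrArg List.tail hn
      simp only [List.cons_append, List.tail_cons] at this
      have hmem : true ∈ u ++ [a] ++ [true] := by simp
      have := List.eq_of_mem_replicate (this ▸ hmem)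
      contradiction
  · refine hnr ⟨B.start, false, Or.inr (B.stateLang_injective_of_minimal hB ?_)⟩
    ext w
    rw [B.mem_stateLang_bwd]
    change w ++ [false] ∈ B.lang ↔ w ∈ B.lang
    rw [hL]
    constructor
    · rintro ⟨n, hn⟩
      cases w with
      | nil => simp at hn
      | cons b w =>
        obtain ⟨rfl, hw⟩ := List.cons.inj hn
        refine ⟨w.length, congrArg _ (List.eq_replicate_iff.2 ⟨rfl, fun c hc => ?_⟩)⟩
        have hmem : c ∈ w.append [false] := List.mem_append_left _ hc
        exact List.eq_of_mem_replicate (hw ▸ hmem)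
    · rintro ⟨n, rfl⟩
      exact ⟨n + 1, congrArg _ List.replicate_succ'.symm⟩
end
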